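/- Let ℓ be a prime and let K be a function field over an algebraically closed field k with char k ≠ ℓ. Let F be a relatively algebraically closed subextension of K|k with trdeg(F|k) = 1, and let v be a discrete valuation of K trivial on k such that Ω_K(F) is not contained in 𝔘_v (the image of U_v in K^×/(K^×)^ℓ). Then the restriction of v to F^× has nontrivial infinite cyclic image and hence determines a discrete valuation w of F trivial on k; this w satisfies that the image of U_w in K^×/(K^×)^ℓ equals Ω_K(F) ∩ 𝔘_v, and w is the unique discrete valuation of F trivial on k whose unit group has image Ω_K(F) ∩ 𝔘_v in K^×/(K^×)^ℓ. -/

import Mathlib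

/-! Common definitions: mod-ℓ Milnor K-theory, K^×/(K^×)^ℓ, Ω_K, relative algebraic
closure, transcendence degree predicates, discrete valuations, etc. -/

noncomputable section

open scoped TensorProduct

universe u v

/-- The `n`-fold tensor power (over `ℤ`) of the multiplicative group `Kˣ`,
written additively. -/
abbrev MilnorPre (n : ℕ) (K : Type*) [Field K] : Type _ :=
  PiTensorProduct ℤ (fun _ : Fin n => Additive Kˣ)

/-- The submodule of Steinberg relations: generated by all `a₁ ⊗ ⋯ ⊗ aₙ`
with `aᵢ + aⱼ = 1` for some `i < j`. -/
def SteinbergRel (n : ℕ) (K : Type*) [Field K] : Submodule ℤ (MilnorPre n K) :=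
  Submodule.span ℤ
    {x | ∃ a : Fin n → Kˣ,
      (∃ i j : Fin n, i < j ∧ ((a i : K) + (a j : K) = 1)) ∧
        x = PiTensorProduct.tprod ℤ (fun i => Additive.ofMul (a i))}

/-- The `n`-th Milnor K-group `K^M_n(K)`: the quotient of the `n`-fold tensor
power of `K^×` by the Steinberg relations. -/
abbrev MilnorK (n : ℕ) (K : Type*) [Field K] : Type _ :=
  MilnorPre n K ⧸ SteinbergRel n K

/-- The mod-`ℓ` Milnor K-group `k^M_n(K) = K^M_n(K)/ℓ`. -/
abbrev MilnorKMod (ℓ n : ℕ) (K : Type*) [Field K] : Type _ :=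
  MilnorK n K ⧸ LinearMap.range ((ℓ : ℤ) • (LinearMap.id : MilnorK n K →ₗ[ℤ] MilnorK n K))

/-- The symbol `{a₁, …, aₙ}` in `k^M_n(K)`. -/
def milnorSymbol (ℓ : ℕ) {n : ℕ} {K : Type*} [Field K] (a : Fin n → Kˣ) :
    MilnorKMod ℓ n K :=
  Submodule.Quotient.mk (Submodule.Quotient.mk
    (PiTensorProduct.tprod ℤ (fun i => Additive.ofMul (a i))))

/-- `k^M_1(K) = K^×/(K^×)^ℓ`, written multiplicatively. -/
abbrev K1 (ℓ : ℕ) (K : Type*) [Field K] : Type _ :=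
  Kˣ ⧸ (powMonoidHom ℓ : Kˣ →* Kˣ).range

/-- The projection `K^× → K^×/(K^×)^ℓ`. -/
def K1proj (ℓ : ℕ) (K : Type*) [Field K] : Kˣ →* K1 ℓ K :=
  QuotientGroup.mk' _

/-- The subgroup of `Kˣ` consisting of the units lying in an intermediate field `L`. -/
def fieldUnits {k K : Type*} [Field k] [Field K] [Algebra k K]
    (L : IntermediateField k K) : Subgroup Kˣ where
  carrier := {x : Kˣ | (x : K) ∈ L}
  one_mem' := by simpa using one_mem L
  mul_mem' := by
    intro a b ha hb
    simpa using mul_mem ha hb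
  inv_mem' := by
    intro a ha
    simpa using inv_mem (show (a : K) ∈ L from ha)

/-- `Ω_K(L)`: the image of `L^×` in `K^×/(K^×)^ℓ`. -/
def Omega (ℓ : ℕ) {k K : Type*} [Field k] [Field K] [Algebra k K]
    (L : IntermediateField k K) : Subgroup (K1 ℓ K) :=
  (fieldUnits L).map (K1proj ℓ K)

/-- A subextension `L` of `K|k` is relatively algebraically closed in `K` if every
element of `K` algebraic over `L` lies in `L`. -/
def RelAlgClosed {k K : Type*} [Field k] [Field K] [Algebra k K]
    (L : IntermediateField k K) : Prop :=
  ∀ x : K, IsAlgebraic L x → x ∈ L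

/-- `K` is a function field over `k`: a finitely generated field extension. -/
def IsFunctionField (k K : Type*) [Field k] [Field K] [Algebra k K] : Prop :=
  ∃ s : Finset K, IntermediateField.adjoin k (s : Set K) = ⊤

/-- `trdeg(K|k) = d`: there is a transcendence basis indexed by `Fin d`. -/
def HasTrdeg (k : Type*) (K : Type*) [Field k] [Field K] [Algebra k K] (d : ℕ) : Prop :=
  ∃ x : Fin d → K, IsTranscendenceBasis k x

/-- `trdeg(K|k) ≥ m`: there are `m` algebraically independent elements. -/
def TrdegGe (k : Type*) (K : Type*) [Field k] [Field K] [Algebra k K] (m : ℕ) : Prop :=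
  ∃ x : Fin m → K, AlgebraicIndependent k x

/-- `dim^M_K(S) ≥ d` for a subset `S ⊆ k^M_1(K)`: there are `s₁, …, s_d ∈ S` with
`{s₁, …, s_d} ≠ 0` in `k^M_d(K)`. -/
def dimMge (ℓ : ℕ) {K : Type*} [Field K] (S : Set (K1 ℓ K)) (d : ℕ) : Prop :=
  ∃ a : Fin d → Kˣ, (∀ i, K1proj ℓ K (a i) ∈ S) ∧ milnorSymbol ℓ a ≠ 0

/-- `dim^M_K(S) = r`. -/
def dimMeq (ℓ : ℕ) {K : Type*} [Field K] (S : Set (K1 ℓ K)) (r : ℕ) : Prop :=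
  dimMge ℓ S r ∧ ¬ dimMge ℓ S (r + 1)

/-- `t` is a general element of `K` over `k`: `t ∉ k` and `k(t)` is relatively
algebraically closed in `K`. -/
def IsGeneralElement (k : Type*) {K : Type*} [Field k] [Field K] [Algebra k K] (t : K) : Prop :=
  t ∉ (⊥ : IntermediateField k K) ∧ RelAlgClosed (IntermediateField.adjoin k {t})

/-- A rational subgroup of `k^M_1(K)`: `Ω_K(k(t))` for a general element `t`. -/
def IsRationalSubgroup (ℓ : ℕ) (k : Type*) {K : Type*} [Field k] [Field K] [Algebra k K]
    (A : Subgroup (K1 ℓ K)) : Prop :=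
  ∃ t : K, IsGeneralElement k t ∧ A = Omega ℓ (IntermediateField.adjoin k {t})

/-- `𝔊^r(K|k)`: the subgroups `Ω_K(L)` for `L` relatively algebraically closed
in `K` of transcendence degree `r` over `k`. -/
def GSet (ℓ : ℕ) (k : Type*) {K : Type*} [Field k] [Field K] [Algebra k K] (r : ℕ) :
    Set (Subgroup (K1 ℓ K)) :=
  {A | ∃ L : IntermediateField k K, RelAlgClosed L ∧ HasTrdeg k L r ∧ A = Omega ℓ L}

/-- `𝔐^1(K)`: subgroups maximal among the subgroups `B` of `k^M_1(K)`
with `dim^M_K(B) = 1`. -/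
def M1Set (ℓ : ℕ) (K : Type*) [Field K] : Set (Subgroup (K1 ℓ K)) :=
  {A | dimMeq ℓ (A : Set (K1 ℓ K)) 1 ∧
    ∀ B : Subgroup (K1 ℓ K), dimMeq ℓ (B : Set (K1 ℓ K)) 1 → A ≤ B → B = A}

/-- Condition (a) and (b) of the maximality characterization of `𝔊^r`:
`B` is generated by rational subgroups and `dim^M_K(B) = r`. -/
def SpannedByRatWithDim (ℓ : ℕ) (k : Type*) {K : Type*} [Field k] [Field K] [Algebra k K]
    (r : ℕ) (B : Subgroup (K1 ℓ K)) : Prop :=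
  (∃ S : Set (Subgroup (K1 ℓ K)), (∀ T ∈ S, IsRationalSubgroup ℓ k T) ∧ B = sSup S) ∧
    dimMeq ℓ (B : Set (K1 ℓ K)) r

/-- A discrete valuation of a field `F`: a surjective homomorphism `F^× → ℤ`
satisfying the ultrametric inequality. -/
structure DiscreteValuation (F : Type*) [Field F] where
  v : Fˣ → ℤ
  map_mul' : ∀ x y : Fˣ, v (x * y) = v x + v y
  surjective' : Function.Surjective v
  min_le' : ∀ x y z : Fˣ, (x : F) + (y : F) = (z : F) → min (v x) (v y) ≤ v z

lemma DiscreteValuation.v_one {F : Type*} [Field F] (w : DiscreteValuation F) : w.v 1 = 0 := by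
  have h := w.map_mul' 1 1
  simp only [mul_one] at h
  omega

/-- A discrete valuation of `F` is trivial on the base field `k`. -/
def DiscreteValuation.TrivialOn (k : Type*) {F : Type*} [Field k] [Field F] [Algebra k F]
    (w : DiscreteValuation F) : Prop :=
  ∀ (c : k) (hc : algebraMap k F c ≠ 0), w.v (Units.mk0 _ hc) = 0

/-- The unit group `U_w ⊆ F^×` of a discrete valuation. -/
def DiscreteValuation.units {F : Type*} [Field F] (w : DiscreteValuation F) : Subgroup Fˣ where
  carrier := {x : Fˣ | w.v x = 0}
  one_mem' := w.v_one
  mul_mem' := by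
    intro a b ha hb
    have h := w.map_mul' a b
    simp only [Set.mem_setOf_eq] at ha hb ⊢
    omega
  inv_mem' := by
    intro a ha
    have h := w.map_mul' a a⁻¹
    rw [mul_inv_cancel] at h
    have h1 := w.v_one
    simp only [Set.mem_setOf_eq] at ha ⊢
    omega

/-- `𝔘_v`: the image of the unit group `U_v` in `K^×/(K^×)^ℓ`. -/
def DiscreteValuation.unitsImage (ℓ : ℕ) {F : Type*} [Field F] (w : DiscreteValuation F) :
    Subgroup (K1 ℓ F) :=
  w.units.map (K1proj ℓ F)

/-- For a discrete valuation `w` of an intermediate field `F` of `K|k`, the image of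
the unit group `U_w` in `K^×/(K^×)^ℓ`. -/
def unitsImageIn (ℓ : ℕ) {k K : Type*} [Field k] [Field K] [Algebra k K]
    (F : IntermediateField k K) (w : DiscreteValuation F) : Subgroup (K1 ℓ K) :=
  (w.units.map (Units.map (algebraMap F K).toMonoidHom)).map (K1proj ℓ K)

/-- The residue field of `v` has transcendence degree `≥ m` over `k`: there are
`v`-units `x₁, …, x_m` whose residues are algebraically independent over `k`,
expressed by saying that every nonzero polynomial over `k` evaluated at the `xᵢ`
is a unit of value `0`. -/
def DiscreteValuation.ResidueTrdegGe (k : Type*) {K : Type*} [Field k] [Field K] [Algebra k K]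
    (v : DiscreteValuation K) (m : ℕ) : Prop :=
  ∃ x : Fin m → Kˣ, (∀ i, v.v (x i) = 0) ∧
    ∀ P : MvPolynomial (Fin m) k, P ≠ 0 →
      ∃ u : Kˣ, (u : K) = MvPolynomial.aeval (fun i => ((x i : K))) P ∧ v.v u = 0

/-- A divisorial-type valuation of `K|k` (where `d = trdeg(K|k)`): a discrete valuation
trivial on `k` whose residue field has transcendence degree exactly `d - 1` over `k`. -/
def IsDivisorialType (k : Type*) {K : Type*} [Field k] [Field K] [Algebra k K] (d : ℕ)
    (v : DiscreteValuation K) : Prop :=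
  v.TrivialOn k ∧ v.ResidueTrdegGe k (d - 1) ∧ ¬ v.ResidueTrdegGe k d

/-- `Δ_A`: the set of subgroups `A ⊓ 𝔘_v`, for `v` ranging over the divisorial-type
valuations of `K` with `A ⊄ 𝔘_v`. -/
def DeltaA (ℓ : ℕ) (k : Type*) {K : Type*} [Field k] [Field K] [Algebra k K] (d : ℕ)
    (A : Subgroup (K1 ℓ K)) : Set (Subgroup (K1 ℓ K)) :=
  {T | ∃ v : DiscreteValuation K, IsDivisorialType k d v ∧
    ¬ A ≤ v.unitsImage ℓ ∧ T = A ⊓ v.unitsImage ℓ}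

/-- A good rational subgroup: a rational subgroup `A = Ω_K(k(t))` such that for every
discrete valuation `w` of `k(t)` trivial on `k`, the image of `U_w` in `K^×/(K^×)^ℓ`
belongs to `Δ_A`. -/
def IsGoodRationalSubgroup (ℓ : ℕ) (k : Type*) {K : Type*} [Field k] [Field K] [Algebra k K]
    (d : ℕ) (A : Subgroup (K1 ℓ K)) : Prop :=
  ∃ t : K, IsGeneralElement k t ∧ A = Omega ℓ (IntermediateField.adjoin k {t}) ∧
    ∀ w : DiscreteValuation (IntermediateField.adjoin k {t}), w.TrivialOn k →
      unitsImageIn ℓ (IntermediateField.adjoin k {t}) w ∈ DeltaA ℓ k d A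

/-- A very general element: a general element `t` such that `Ω_K(k(t))` is a good
rational subgroup. -/
def IsVeryGeneral (ℓ : ℕ) (k : Type*) {K : Type*} [Field k] [Field K] [Algebra k K]
    (d : ℕ) (t : K) : Prop :=
  IsGeneralElement k t ∧ IsGoodRationalSubgroup ℓ k d (Omega ℓ (IntermediateField.adjoin k {t}))

/-- `x` is separable in `K`: in characteristic `p > 0`, `x` is not a `p`-th power;
in characteristic `0` every element is separable. -/
def IsSeparableIn (K : Type*) [Field K] (x : K) : Prop :=
  ∀ p : ℕ, p.Prime → CharP K p → ¬ ∃ y : K, y ^ p = x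

/-- A perfect closure of `K`: a perfect field which is a purely inseparable
extension of `K`. -/
structure PerfectClosureOf (K : Type u) [Field K] : Type (u + 1) where
  carrier : Type u
  [fieldInst : Field carrier]
  [algebraInst : Algebra K carrier]
  purelyInseparable : IsPurelyInseparable K carrier
  perfect : PerfectField carrier

attribute [instance] PerfectClosureOf.fieldInst PerfectClosureOf.algebraInst

/-- A group isomorphism `φ : k^M_1(K) → k^M_1(L)` is induced by a field isomorphism
`σ : K^i → L^i` of the perfect closures, via the canonical identifications
`k^M_1(K) ≅ k^M_1(K^i)` and `k^M_1(L) ≅ k^M_1(L^i)`. -/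
def InducesOnK1 (ℓ : ℕ) {K : Type u} {L : Type v} [Field K] [Field L]
    (PK : PerfectClosureOf K) (PL : PerfectClosureOf L)
    (σ : PK.carrier ≃+* PL.carrier) (φ : K1 ℓ K ≃* K1 ℓ L) : Prop :=
  ∀ (x : Kˣ) (y : Lˣ),
    (φ (K1proj ℓ K x) = K1proj ℓ L y ↔
      ∃ z : (PL.carrier)ˣ,
        Units.map σ.toRingHom.toMonoidHom
            (Units.map (algebraMap K PK.carrier).toMonoidHom x) =
          Units.map (algebraMap L PL.carrier).toMonoidHom y * z ^ ℓ)

/-- `φ : k^M_1(K) → k^M_1(L)` is compatible with `k^M_2`: `φ ⊗ φ` descends, along the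
multiplication maps, to an isomorphism `k^M_2(K) → k^M_2(L)`; equivalently, there is an
additive isomorphism `k^M_2(K) ≃ k^M_2(L)` carrying `{a, b}` to `{a', b'}` whenever
`φ` carries the class of `a` (resp. `b`) to the class of `a'` (resp. `b'`). -/
def CompatWithK2 (ℓ : ℕ) {K L : Type*} [Field K] [Field L] (φ : K1 ℓ K ≃* K1 ℓ L) : Prop :=
  ∃ ψ : MilnorKMod ℓ 2 K ≃+ MilnorKMod ℓ 2 L,
    ∀ (a b : Kˣ) (a' b' : Lˣ),
      φ (K1proj ℓ K a) = K1proj ℓ L a' → φ (K1proj ℓ K b) = K1proj ℓ L b' →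
        ψ (milnorSymbol ℓ ![a, b]) = milnorSymbol ℓ ![a', b']

/-- `φ : k^M_1(K) → k^M_1(L)` is compatible with `𝔊^1_rat`: it maps rational subgroups
bijectively onto rational subgroups. -/
def CompatWithRat (ℓ : ℕ) (k : Type*) (l : Type*) {K L : Type*}
    [Field k] [Field K] [Algebra k K] [Field l] [Field L] [Algebra l L]
    (φ : K1 ℓ K ≃* K1 ℓ L) : Prop :=
  (∀ A : Subgroup (K1 ℓ K), IsRationalSubgroup ℓ k A →
     IsRationalSubgroup ℓ l (A.map φ.toMonoidHom)) ∧
  (∀ B : Subgroup (K1 ℓ L), IsRationalSubgroup ℓ l B →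
     ∃ A : Subgroup (K1 ℓ K), IsRationalSubgroup ℓ k A ∧ A.map φ.toMonoidHom = B)

/-- Two isomorphisms of perfect closures differ by a power of the Frobenius
(in characteristic `0`, they are equal). -/
def FrobTwistEquiv {Ki Li : Type*} [Field Ki] [Field Li] (σ σ' : Ki ≃+* Li) : Prop :=
  σ = σ' ∨ ∃ p : ℕ, p.Prime ∧ CharP Ki p ∧
    ((∃ n : ℕ, ∀ x, σ' x = σ (x ^ p ^ n)) ∨ (∃ n : ℕ, ∀ x, σ x = σ' (x ^ p ^ n)))

namespace DiscreteValuation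

variable {F : Type*} [Field F]

/-- A discrete valuation as a homomorphism to `ℤ`. -/
def toHom (w : DiscreteValuation F) : Fˣ →* Multiplicative ℤ where
  toFun x := Multiplicative.ofAdd (w.v x)
  map_one' := by rw [w.v_one]; rfl
  map_mul' x y := by rw [w.map_mul']; rfl

lemma v_inv (w : DiscreteValuation F) (x : Fˣ) : w.v x⁻¹ = -w.v x :=
  congrArg Multiplicative.toAdd (map_inv w.toHom x)

lemma v_zpow (w : DiscreteValuation F) (x : Fˣ) (n : ℤ) : w.v (x ^ n) = n * w.v x := by
  have h := congrArg Multiplicative.toAdd (map_zpow w.toHom x n)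
  rwa [toAdd_zpow, smul_eq_mul] at h

lemma v_pow (w : DiscreteValuation F) (x : Fˣ) (n : ℕ) : w.v (x ^ n) = n * w.v x := by
  simpa using w.v_zpow x n

lemma v_neg (w : DiscreteValuation F) (x : Fˣ) : w.v (-x) = w.v x := by
  have h : w.v (-1) + w.v (-1) = 0 := by
    rw [← w.map_mul', neg_one_mul, neg_neg, w.v_one]
  rw [← neg_one_mul, w.map_mul']
  omega

lemma v_eq_left_of_lt (w : DiscreteValuation F) {x y z : Fˣ} (h : (x : F) + y = z)
    (hlt : w.v x < w.v y) : w.v z = w.v x := by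
  have h1 := w.min_le' x y z h
  have h2 := w.min_le' z (-y) x (by rw [← h, Units.val_neg]; ring)
  rw [w.v_neg] at h2
  omega

lemma v_eq_right_of_lt (w : DiscreteValuation F) {x y z : Fˣ} (h : (x : F) + y = z)
    (hlt : w.v y < w.v x) : w.v z = w.v y :=
  w.v_eq_left_of_lt (by rw [← h, add_comm]) hlt

lemma add_ne_zero_of_v_ne (w : DiscreteValuation F) {x y : Fˣ} (h : w.v x ≠ w.v y) :
    (x : F) + y ≠ 0 := by
  intro h0
  apply h
  rw [show x = -y from Units.ext (by rw [Units.val_neg]; exact eq_neg_of_add_eq_zero_left h0),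
    w.v_neg]

lemma ext_v {w w' : DiscreteValuation F} (h : ∀ x, w.v x = w'.v x) : w = w' := by
  cases w
  cases w'
  congr
  exact funext h

/-- Two distinct discrete valuations are separated by the sign of their values. -/
lemma exists_pos_neg_of_ne {w w' : DiscreteValuation F} (hne : w' ≠ w) :
    ∃ z, 0 < w.v z ∧ w'.v z < 0 := by
  by_contra! hcon
  apply hne
  obtain ⟨t, ht⟩ := w.surjective' 1
  have hunit : ∀ x, w.v x = 0 → w'.v x = 0 := by
    intro x hx
    have key : ∀ n : ℤ, 0 ≤ w'.v t + n * w'.v x := by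
      intro n
      have := hcon (t * x ^ n) (by rw [w.map_mul', w.v_zpow, ht, hx]; simp)
      rwa [w'.map_mul', w'.v_zpow] at this
    by_contra hx'
    have h2 := key (-(w'.v t + 1) * w'.v x)
    have h3 : 1 ≤ w'.v x * w'.v x := by
      have := mul_self_pos.2 hx'
      omega
    have h4 := hcon t (by omega)
    nlinarith
  have hmul : ∀ x, w'.v x = w.v x * w'.v t := by
    intro x
    have h0 := hunit (x * t ^ (-w.v x)) (by rw [w.map_mul', w.v_zpow, ht]; ring)
    rw [w'.map_mul', w'.v_zpow] at h0
    linarith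
  have h1 : w'.v t = 1 := by
    obtain ⟨s, hs⟩ := w'.surjective' 1
    rw [hmul] at hs
    have hd : w'.v t ∣ 1 := ⟨w.v s, by rw [mul_comm]; exact hs.symm⟩
    exact Int.eq_one_of_dvd_one (hcon t (by omega)) hd
  exact ext_v fun x => by rw [hmul, h1, mul_one]

/-- Weak approximation for two distinct discrete valuations: there is a unit of one which is
a uniformizer of the other. -/
lemma exists_uniformizer_unit_of_ne {w w' : DiscreteValuation F} (hne : w' ≠ w) :
    ∃ x, w.v x = 1 ∧ w'.v x = 0 := by
  obtain ⟨z, hz, hz'⟩ := exists_pos_neg_of_ne hne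
  obtain ⟨t, ht⟩ := w.surjective' 1
  obtain ⟨n, hn, hn'⟩ : ∃ n : ℕ, 2 ≤ n ∧ -(n : ℤ) < w'.v t :=
    ⟨2 + (w'.v t).natAbs, by omega, by omega⟩
  have hn2 : (2 : ℤ) ≤ n := by exact_mod_cast hn
  have hy : 1 < w.v (z ^ n) := by
    rw [w.v_pow]
    nlinarith
  have hy' : w'.v (z ^ n) ≤ -n := by
    rw [w'.v_pow]
    nlinarith
  generalize z ^ n = y at hy hy'
  have ha := w.add_ne_zero_of_v_ne (x := t) (y := y) (by omega)
  have hb := w.add_ne_zero_of_v_ne (x := 1) (y := y) (by rw [w.v_one]; omega)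
  let a := Units.mk0 _ ha
  let b := Units.mk0 _ hb
  have hta : (t : F) + y = a := rfl
  have htb : ((1 : Fˣ) : F) + y = b := rfl
  refine ⟨a * b⁻¹, ?_, ?_⟩
  · rw [w.map_mul', w.v_inv, w.v_eq_left_of_lt hta (by omega),
      w.v_eq_left_of_lt htb (by rw [w.v_one]; omega), ht, w.v_one]
    rfl
  · rw [w'.map_mul', w'.v_inv, w'.v_eq_right_of_lt hta (by omega),
      w'.v_eq_right_of_lt htb (by rw [w'.v_one]; omega)]
    omega

/-- A discrete valuation which is nontrivial on a subfield restricts, up to a positive factor,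
to a discrete valuation of that subfield. -/
lemma exists_restrict {E : Type*} [Field E] (v : DiscreteValuation E) (i : F →+* E)
    (hne : ∃ u : Fˣ, v.v (Units.map i.toMonoidHom u) ≠ 0) :
    ∃ w : DiscreteValuation F, ∃ e : ℤ, 0 < e ∧
      ∀ u : Fˣ, v.v (Units.map i.toMonoidHom u) = e * w.v u := by
  let f : Additive Fˣ →+ ℤ := MonoidHom.toAdditiveLeft (v.toHom.comp (Units.map i.toMonoidHom))
  have hf : ∀ u : Fˣ, f (Additive.ofMul u) = v.v (Units.map i.toMonoidHom u) := fun _ => rfl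
  obtain ⟨a, ha⟩ := Int.subgroup_cyclic f.range
  have hdvd : ∀ u : Fˣ, |a| ∣ v.v (Units.map i.toMonoidHom u) := by
    intro u
    have hu : v.v (Units.map i.toMonoidHom u) ∈ f.range := ⟨Additive.ofMul u, rfl⟩
    rw [ha, AddSubgroup.mem_closure_singleton] at hu
    obtain ⟨n, hn⟩ := hu
    exact (abs_dvd _ _).2 ⟨n, by rw [← hn, smul_eq_mul, mul_comm]⟩
  have hpos : 0 < |a| := by
    obtain ⟨u, hu⟩ := hne
    refine abs_pos.2 fun h0 => hu ?_
    simpa [h0] using hdvd u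
  obtain ⟨t, ht⟩ : ∃ t : Fˣ, v.v (Units.map i.toMonoidHom t) = |a| := by
    have hmem : a ∈ f.range := by
      rw [ha]
      exact AddSubgroup.subset_closure rfl
    have : |a| ∈ f.range := by
      rcases abs_choice a with h | h <;> rw [h]
      exacts [hmem, neg_mem hmem]
    obtain ⟨t, ht⟩ := this
    exact ⟨t.toMul, ht⟩
  choose g hg using hdvd
  have hcancel : ∀ {m n : ℤ}, |a| * m = |a| * n → m = n := fun h =>
    mul_left_cancel₀ hpos.ne' h
  have hmul : ∀ x y, g (x * y) = g x + g y := fun x y =>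
    hcancel (by rw [mul_add, ← hg, ← hg, ← hg, map_mul, v.map_mul'])
  refine ⟨⟨g, hmul, fun n => ⟨t ^ n, hcancel ?_⟩, fun x y z hxyz => ?_⟩, |a|, hpos, hg⟩
  · rw [← hg, map_zpow, v.v_zpow, ht, mul_comm]
  · have h := v.min_le' (Units.map i.toMonoidHom x) (Units.map i.toMonoidHom y)
      (Units.map i.toMonoidHom z) (by simpa using congrArg i hxyz)
    rw [hg, hg, hg, min_le_iff] at h
    rw [min_le_iff]
    exact h.imp (fun h => le_of_mul_le_mul_left h hpos) (fun h => le_of_mul_le_mul_left h hpos)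

/-- A class mod `ℓ`-th powers comes from a unit exactly when its value is divisible by `ℓ`. -/
lemma K1proj_mem_unitsImage_iff (ℓ : ℕ) (w : DiscreteValuation F) (x : Fˣ) :
    K1proj ℓ F x ∈ w.unitsImage ℓ ↔ (ℓ : ℤ) ∣ w.v x := by
  constructor
  · rintro ⟨u, hu, hux⟩
    obtain ⟨z, ⟨y, rfl⟩, hz⟩ := (QuotientGroup.mk'_eq_mk' _).1 hux
    refine ⟨w.v y, ?_⟩
    rw [← hz, w.map_mul', show w.v u = 0 from hu, zero_add]
    exact w.v_pow y ℓ
  · rintro ⟨m, hm⟩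
    obtain ⟨y, hy⟩ := w.surjective' m
    refine ⟨x * (y ^ ℓ)⁻¹, ?_, (QuotientGroup.mk'_eq_mk' _).2 ⟨y ^ ℓ, ⟨y, rfl⟩, by group⟩⟩
    change w.v _ = 0
    rw [w.map_mul', w.v_inv, w.v_pow, hm, hy]
    ring

end DiscreteValuation

lemma mem_Omega_iff (ℓ : ℕ) {k K : Type*} [Field k] [Field K] [Algebra k K]
    (F : IntermediateField k K) (a : K1 ℓ K) :
    a ∈ Omega ℓ F ↔ ∃ u : Fˣ, K1proj ℓ K (Units.map (algebraMap F K).toMonoidHom u) = a := by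
  constructor
  · rintro ⟨x, hx, rfl⟩
    have hx0 : (⟨x, hx⟩ : F) ≠ 0 := fun h => x.ne_zero (congrArg Subtype.val h)
    exact ⟨Units.mk0 _ hx0, congrArg _ (Units.ext rfl)⟩
  · rintro ⟨u, rfl⟩
    exact ⟨_, (u : F).2, rfl⟩

lemma mem_unitsImageIn_iff (ℓ : ℕ) {k K : Type*} [Field k] [Field K] [Algebra k K]
    (F : IntermediateField k K) (w : DiscreteValuation F) (a : K1 ℓ K) :
    a ∈ unitsImageIn ℓ F w ↔
      ∃ u : Fˣ, w.v u = 0 ∧ K1proj ℓ K (Units.map (algebraMap F K).toMonoidHom u) = a := by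
  constructor
  · rintro ⟨_, ⟨u, hu, rfl⟩, rfl⟩
    exact ⟨u, hu, rfl⟩
  · rintro ⟨u, hu, rfl⟩
    exact ⟨_, ⟨u, hu, rfl⟩, rfl⟩

theorem statement_12 (ℓ : ℕ) (hℓ : ℓ.Prime) (k K : Type*) [Field k] [Field K] [Algebra k K]
    [IsAlgClosed k] (hchar : ringChar k ≠ ℓ) (hK : IsFunctionField k K)
    (F : IntermediateField k K) (hF : RelAlgClosed F) (h1 : HasTrdeg k F 1)
    (v : DiscreteValuation K) (hv : v.TrivialOn k)
    (hns : ¬ Omega ℓ F ≤ v.unitsImage ℓ) :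
    ∃ w : DiscreteValuation F, w.TrivialOn k ∧
      (∃ e : ℤ, 0 < e ∧
        ∀ u : Fˣ, v.v (Units.map (algebraMap F K).toMonoidHom u) = e * w.v u) ∧
      unitsImageIn ℓ F w = Omega ℓ F ⊓ v.unitsImage ℓ ∧
      ∀ w' : DiscreteValuation F, w'.TrivialOn k →
        unitsImageIn ℓ F w' = Omega ℓ F ⊓ v.unitsImage ℓ → w' = w := by
  obtain ⟨_, ha, hav⟩ := SetLike.not_le_iff_exists.1 hns
  obtain ⟨u₀, rfl⟩ := (mem_Omega_iff ℓ F _).1 ha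
  rw [v.K1proj_mem_unitsImage_iff] at hav
  obtain ⟨w, e, he, hw⟩ := v.exists_restrict (algebraMap F K)
    ⟨u₀, fun h => hav (h ▸ dvd_zero _)⟩
  have hdvd : ∀ u : Fˣ, K1proj ℓ K (Units.map (algebraMap F K).toMonoidHom u) ∈
      v.unitsImage ℓ ↔ (ℓ : ℤ) ∣ w.v u := by
    intro u
    rw [v.K1proj_mem_unitsImage_iff, hw]
    refine ⟨fun h => ((Nat.prime_iff_prime_int.1 hℓ).dvd_or_dvd h).resolve_left fun h' => hav ?_,
      fun h => h.mul_left e⟩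
    rw [hw]
    exact h'.mul_right _
  refine ⟨w, fun c hc => ?_, ⟨e, he, hw⟩, ?_, fun w' _ hw' => ?_⟩
  · have hcK : algebraMap k K c ≠ 0 := fun h => hc (Subtype.ext h)
    have h := hw (Units.mk0 _ hc)
    rw [show Units.map (algebraMap F K).toMonoidHom (Units.mk0 _ hc) = Units.mk0 _ hcK from
      Units.ext rfl, hv c hcK] at h
    exact (mul_eq_zero.1 h.symm).resolve_left he.ne'
  · ext a
    rw [Subgroup.mem_inf, mem_unitsImageIn_iff, mem_Omega_iff]
    constructor
    · rintro ⟨u, hu, rfl⟩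
      exact ⟨⟨u, rfl⟩, (hdvd u).2 (hu ▸ dvd_zero _)⟩
    · rintro ⟨⟨u, rfl⟩, hu⟩
      obtain ⟨x, hx, hxu⟩ := (w.K1proj_mem_unitsImage_iff ℓ u).2 ((hdvd u).1 hu)
      obtain ⟨z, ⟨y, rfl⟩, hz⟩ := (QuotientGroup.mk'_eq_mk' _).1 hxu
      refine ⟨x, hx, (QuotientGroup.mk'_eq_mk' _).2
        ⟨_, ⟨Units.map (algebraMap F K).toMonoidHom y, rfl⟩, ?_⟩⟩
      rw [← hz, map_mul, powMonoidHom_apply, powMonoidHom_apply, map_pow]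
  · by_contra hne
    obtain ⟨x, hx, hx'⟩ := DiscreteValuation.exists_uniformizer_unit_of_ne hne
    have hmem := (mem_unitsImageIn_iff ℓ F w' _).2 ⟨x, hx', rfl⟩
    rw [hw', Subgroup.mem_inf, hdvd, hx] at hmem
    exact hℓ.one_lt.ne' (Nat.dvd_one.1 (by exact_mod_cast hmem.2))

end
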